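/- arXiv:2212.06886 — 2 statements merged into one kernel-verified Lean document; each statement's English description precedes it below -/
import Mathlib

section
/- Let K be a field of characteristic ≠ 2, σ a ring automorphism of K with σ ∘ σ = id and σ ≠ id, and F = K^σ its fixed field. Let a, b ∈ K be nonzero, let L = ℍ[K, a, b] be the quaternion algebra over K with main involution l ↦ star l, and let τ be an involution of the second kind on L. Set C = {l ∈ L : τ(star l) = l}. Then: (1) C is an F-subalgebra of L; (2) C is stable under the main involution, and τ(c) = star c for every c ∈ C; (3) the multiplication map K ⊗_F C → L, k ⊗ c ↦ k • c, is an isomorphism of K-algebras; in particular C is a 4-dimensional central simple F-algebra (a quaternion algebra over F). Consequently L ≅ C ⊗_F K as K-algebras, and under this isomorphism τ corresponds to the involution c ⊗ k ↦ star c ⊗ σ(k). -/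
open scoped Quaternion TensorProduct

set_option synthInstance.maxHeartbeats 1000000
set_option maxHeartbeats 1000000

noncomputable section

namespace CherednikDescent

variable {K : Type*} [Field K]

/-- The fixed field `F = K^σ` of a ring automorphism `σ` of `K`, as a subfield of `K`. -/
def fixedSubfield (σ : K ≃+* K) : Subfield K where
  carrier := {x | σ x = x}
  one_mem' := map_one σ
  zero_mem' := map_zero σ
  mul_mem' := by
    intro x y hx hy
    simp only [Set.mem_setOf_eq] at *
    rw [map_mul, hx, hy]
  add_mem' := by
    intro x y hx hy
    simp only [Set.mem_setOf_eq] at *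
    rw [map_add, hx, hy]
  neg_mem' := by
    intro x hx
    simp only [Set.mem_setOf_eq] at *
    rw [map_neg, hx]
  inv_mem' := by
    intro x hx
    simp only [Set.mem_setOf_eq] at *
    rw [map_inv₀, hx]

/-- The multiplication map `K ⊗_F C → L`, `k ⊗ c ↦ k • c`, as a `K`-algebra homomorphism,
where `F = K^σ` and `C` is an `F`-subalgebra of `L = ℍ[K, a, b]`. -/
def multMap (σ : K ≃+* K) (a b : K)
    (S : Subalgebra (fixedSubfield σ) ℍ[K, a, b]) :
    (K ⊗[fixedSubfield σ] S) →ₐ[K] ℍ[K, a, b] :=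
  Algebra.TensorProduct.lift (Algebra.ofId K ℍ[K, a, b]) S.val
    (fun x y => by
      simpa [Algebra.ofId_apply] using Algebra.commute_algebraMap_left x (S.val y))

/-- A quaternion basis with nonzero parameters in a nontrivial algebra over a field of
characteristic `≠ 2` is linearly independent. -/
lemma liftHom_injective {F A : Type*} [Field F] [Ring A] [Nontrivial A] [Algebra F A]
    (htwo : (2 : F) ≠ 0) {a b : F} (ha : a ≠ 0) (hb : b ≠ 0)
    (B : QuaternionAlgebra.Basis A a 0 b) : Function.Injective B.liftHom := by
  have hi : B.i * B.i = a • (1 : A) := by simp [B.i_mul_i]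
  have hj : B.j * B.j = b • (1 : A) := B.j_mul_j
  have hji : B.j * B.i = -(B.i * B.j) := by rw [B.j_mul_i, B.i_mul_j]; simp
  have key : ∀ q₀ q₁ : F, q₀ • (1 : A) + q₁ • B.i = 0 → q₀ = 0 ∧ q₁ = 0 := by
    intro q₀ q₁ h
    have h₀ : (2 * q₀ * b) • (1 : A) = 0 := by
      calc (2 * q₀ * b) • (1 : A)
          = B.j * (B.j * (q₀ • (1 : A) + q₁ • B.i) + (q₀ • (1 : A) + q₁ • B.i) * B.j) := by
            simp only [mul_add, add_mul, mul_smul_comm, smul_mul_assoc, mul_one, one_mul, hji,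
              mul_neg, hj]
            module
        _ = 0 := by simp [h]
    have hq₀ : q₀ = 0 := by simpa [htwo, hb] using h₀
    have h₁ : (q₁ * a) • (1 : A) = 0 := by
      calc (q₁ * a) • (1 : A) = (q₀ • (1 : A) + q₁ • B.i) * B.i := by
            simp [hq₀, hi, mul_smul]
        _ = 0 := by simp [h]
    exact ⟨hq₀, by simpa [ha] using h₁⟩
  rw [injective_iff_map_eq_zero]
  intro q hq
  have hq' : q.re • (1 : A) + q.imI • B.i + q.imJ • B.j + q.imK • (B.i * B.j) = 0 := by
    simpa [QuaternionAlgebra.Basis.lift, Algebra.algebraMap_eq_smul_one, B.i_mul_j] using hq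
  set x := q.re • (1 : A) + q.imI • B.i + q.imJ • B.j + q.imK • (B.i * B.j) with hx
  have h₁ : (2 * a) • (q.re • (1 : A) + q.imI • B.i) = 0 := by
    calc (2 * a) • (q.re • (1 : A) + q.imI • B.i) = B.i * (B.i * x + x * B.i) := by
          have e₁ : B.i * (B.i * x) = a • x := by rw [← mul_assoc, hi, smul_one_mul]
          have e₂ : B.i * (x * B.i)
              = a • (q.re • (1 : A) + q.imI • B.i - q.imJ • B.j - q.imK • (B.i * B.j)) := by
            have e₃ : x * B.i
                = B.i * (q.re • (1 : A) + q.imI • B.i - q.imJ • B.j - q.imK • (B.i * B.j)) := by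
              simp only [hx, mul_add, mul_sub, add_mul, mul_smul_comm, smul_mul_assoc, mul_one,
                one_mul, mul_assoc, hji, mul_neg]
              module
            rw [e₃, ← mul_assoc, hi, smul_one_mul]
          rw [mul_add, e₁, e₂, hx]
          module
      _ = 0 := by simp [hq']
  obtain ⟨hre, hI⟩ := key _ _ ((smul_eq_zero_iff_right (mul_ne_zero htwo ha)).1 h₁)
  have h₂ : b • (q.imJ • (1 : A) + q.imK • B.i) = 0 := by
    calc b • (q.imJ • (1 : A) + q.imK • B.i) = x * B.j := by
          simp only [hx, hre, hI, zero_smul, zero_add, add_mul, smul_mul_assoc, mul_assoc, hj,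
            mul_smul_comm, mul_one]
          module
      _ = 0 := by simp [hq']
  obtain ⟨hJ, hK⟩ := key _ _ ((smul_eq_zero_iff_right hb).1 h₂)
  ext <;> simpa

section Semilinear

variable {σ : K ≃+* K} {a b : K} {θ : ℍ[K, a, b] →+* ℍ[K, a, b]}

/-- The fixed points of a `σ`-semilinear ring endomorphism, as an algebra over `K^σ`. -/
def fixedSubalgebra (σ : K ≃+* K) (θ : ℍ[K, a, b] →+* ℍ[K, a, b])
    (hθ : ∀ (k : K) (x : ℍ[K, a, b]), θ (k • x) = σ k • θ x) :
    Subalgebra (fixedSubfield σ) ℍ[K, a, b] where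
  carrier := {x | θ x = x}
  mul_mem' := by
    intro x y hx hy
    simp only [Set.mem_ofPred_eq] at *
    rw [map_mul, hx, hy]
  add_mem' := by
    intro x y hx hy
    simp only [Set.mem_ofPred_eq] at *
    rw [map_add, hx, hy]
  algebraMap_mem' := by
    intro r
    have hr : σ (r : K) = r := r.2
    rw [Set.mem_ofPred_eq, Algebra.algebraMap_eq_smul_one, Subfield.smul_def, hθ, map_one, hr]

lemma mul_self_of_re_eq_zero {x : ℍ[K, a, b]} (hx : x.re = 0) :
    x * x = (a * x.imI ^ 2 + b * x.imJ ^ 2 - a * b * x.imK ^ 2) • (1 : ℍ[K, a, b]) := by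
  ext <;> simp [hx] <;> ring

lemma re_map_eq_zero (htwo : (2 : K) ≠ 0) (hσ : ∀ x, σ (σ x) = x)
    (hθ : ∀ (k : K) (x : ℍ[K, a, b]), θ (k • x) = σ k • θ x)
    (hinj : Function.Injective θ) {x : ℍ[K, a, b]} (hx : x.re = 0) : (θ x).re = 0 := by
  by_contra hre
  set y := θ x with hy
  have hyy : y * y =
      σ (a * x.imI ^ 2 + b * x.imJ ^ 2 - a * b * x.imK ^ 2) • (1 : ℍ[K, a, b]) := by
    rw [hy, ← map_mul, mul_self_of_re_eq_zero hx, hθ, map_one]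
  have hI : 2 * y.re * y.imI = 0 := by
    have := congrArg QuaternionAlgebra.imI hyy
    simp at this
    linear_combination this
  have hJ : 2 * y.re * y.imJ = 0 := by
    have := congrArg QuaternionAlgebra.imJ hyy
    simp at this
    linear_combination this
  have hK : 2 * y.re * y.imK = 0 := by
    have := congrArg QuaternionAlgebra.imK hyy
    simp at this
    linear_combination this
  have hyc : y = y.re • (1 : ℍ[K, a, b]) := by
    ext
    · simp
    · simpa [htwo, hre] using hI
    · simpa [htwo, hre] using hJ
    · simpa [htwo, hre] using hK
  have hxc : x = σ y.re • (1 : ℍ[K, a, b]) := hinj (by rw [hθ, hσ, map_one]; exact hyc)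
  have h0 : σ y.re = 0 := by
    have := congrArg QuaternionAlgebra.re hxc
    simpa [hx] using this.symm
  exact hre (by simpa using h0)

lemma map_star_of_semilinear (htwo : (2 : K) ≠ 0) (hσ : ∀ x, σ (σ x) = x)
    (hθ : ∀ (k : K) (x : ℍ[K, a, b]), θ (k • x) = σ k • θ x)
    (hinj : Function.Injective θ) (x : ℍ[K, a, b]) : θ (star x) = star (θ x) := by
  have h : (θ x.im).re = 0 := re_map_eq_zero htwo hσ hθ hinj (by simp)
  have hx : x = x.re • (1 : ℍ[K, a, b]) + x.im := by ext <;> simp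
  have hs : star x = x.re • (1 : ℍ[K, a, b]) - x.im := by ext <;> simp
  have hx' : θ x = σ x.re • (1 : ℍ[K, a, b]) + θ x.im := by
    conv_lhs => rw [hx, map_add, hθ, map_one]
  have hn : star (θ x.im) = -θ x.im := by ext <;> simp [h]
  rw [hs, map_sub, hθ, map_one, hx', star_add, hn,
    QuaternionAlgebra.star_smul', star_one, sub_eq_add_neg]

lemma exists_ne_zero_map_eq_neg (hσ : ∀ x, σ (σ x) = x)
    (hne : σ ≠ RingEquiv.refl K) : ∃ d : K, d ≠ 0 ∧ σ d = -d := by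
  obtain ⟨x, hx⟩ : ∃ x, σ x ≠ x := by
    by_contra! h
    exact hne (RingEquiv.ext h)
  exact ⟨x - σ x, sub_ne_zero.2 hx.symm, by rw [map_sub, hσ, neg_sub]⟩

lemma exists_fixed_add_smul_fixed (htwo : (2 : K) ≠ 0)
    (hθ : ∀ (k : K) (x : ℍ[K, a, b]), θ (k • x) = σ k • θ x) (hinv : ∀ x, θ (θ x) = x)
    {d : K} (hd : d ≠ 0) (hσd : σ d = -d) (P : Submodule K ℍ[K, a, b])
    (hP : ∀ x ∈ P, θ x ∈ P) {x : ℍ[K, a, b]} (hx : x ∈ P) :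
    ∃ c ∈ P, ∃ c' ∈ P, θ c = c ∧ θ c' = c' ∧ x = c + d • c' := by
  refine ⟨(2⁻¹ : K) • (x + θ x), P.smul_mem _ (P.add_mem hx (hP x hx)),
    (2 * d)⁻¹ • (x - θ x), P.smul_mem _ (P.sub_mem hx (hP x hx)), ?_, ?_, ?_⟩
  · rw [hθ, map_add, hinv, map_inv₀, map_ofNat, add_comm]
  · rw [hθ, map_sub, hinv, map_inv₀, map_mul, map_ofNat, hσd, mul_neg, inv_neg, neg_smul,
      ← smul_neg, neg_sub]
  · rw [smul_smul]
    have : d * (2 * d)⁻¹ = 2⁻¹ := by field_simp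
    rw [this, ← smul_add, add_add_sub_cancel, ← two_smul K, smul_smul, inv_mul_cancel₀ htwo,
      one_smul]

lemma exists_fixed_mul_self_ne_zero (htwo : (2 : K) ≠ 0)
    (hθ : ∀ (k : K) (x : ℍ[K, a, b]), θ (k • x) = σ k • θ x) (hinv : ∀ x, θ (θ x) = x)
    {d : K} (hd : d ≠ 0) (hσd : σ d = -d) (P : Submodule K ℍ[K, a, b])
    (hP : ∀ x ∈ P, θ x ∈ P) {x : ℍ[K, a, b]} (hx : x ∈ P) (hxx : x * x ≠ 0) :
    ∃ c ∈ P, θ c = c ∧ c * c ≠ 0 := by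
  obtain ⟨c, hc, c', hc', hθc, hθc', rfl⟩ :=
    exists_fixed_add_smul_fixed htwo hθ hinv hd hσd P hP hx
  by_contra! H
  have h₁ := H c hc hθc
  have h₂ := H c' hc' hθc'
  have h₃ := H (c + c') (P.add_mem hc hc') (by rw [map_add, hθc, hθc'])
  rw [mul_add, add_mul, add_mul, h₁, h₂, zero_add, add_zero] at h₃
  apply hxx
  rw [mul_add, add_mul, add_mul, h₁, mul_smul_comm, smul_mul_smul_comm, h₂, smul_mul_assoc,
    smul_zero, zero_add, add_zero, ← smul_add, h₃, smul_zero]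

variable (a b) in
/-- The pure quaternions. -/
def pureSubmodule : Submodule K ℍ[K, a, b] := LinearMap.ker (QuaternionAlgebra.reₗ a 0 b)

/-- The pure quaternions anticommuting with `i`. -/
def anticommSubmodule (i : ℍ[K, a, b]) : Submodule K ℍ[K, a, b] :=
  pureSubmodule a b ⊓ LinearMap.ker (LinearMap.mulLeft K i + LinearMap.mulRight K i)

lemma mem_anticommSubmodule {i x : ℍ[K, a, b]} :
    x ∈ anticommSubmodule i ↔ x.re = 0 ∧ i * x + x * i = 0 := Iff.rfl

lemma exists_anticomm_mul_self_ne_zero (htwo : (2 : K) ≠ 0) (ha : a ≠ 0) (hb : b ≠ 0)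
    {i : ℍ[K, a, b]} (hi : i.re = 0) (hii : i * i ≠ 0) :
    ∃ x ∈ anticommSubmodule i, x * x ≠ 0 := by
  by_contra! H
  have e₁ := H ⟨0, -b * i.imJ, a * i.imI, 0⟩
    (mem_anticommSubmodule.2 ⟨rfl, by ext <;> simp [hi] <;> ring⟩)
  have e₂ := H ⟨0, b * i.imK, 0, i.imI⟩
    (mem_anticommSubmodule.2 ⟨rfl, by ext <;> simp [hi] <;> ring⟩)
  have e₃ := H ⟨0, 0, a * i.imK, i.imJ⟩
    (mem_anticommSubmodule.2 ⟨rfl, by ext <;> simp [hi] <;> ring⟩)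
  replace e₁ := congrArg QuaternionAlgebra.re e₁
  replace e₂ := congrArg QuaternionAlgebra.re e₂
  replace e₃ := congrArg QuaternionAlgebra.re e₃
  simp at e₁ e₂ e₃
  have f₁ : a * i.imI ^ 2 + b * i.imJ ^ 2 = 0 :=
    mul_left_cancel₀ (mul_ne_zero ha hb) (by linear_combination e₁)
  have f₂ : b * i.imK ^ 2 - i.imI ^ 2 = 0 :=
    mul_left_cancel₀ (mul_ne_zero ha hb) (by linear_combination e₂)
  have f₃ : a * i.imK ^ 2 - i.imJ ^ 2 = 0 :=
    mul_left_cancel₀ (mul_ne_zero ha hb) (by linear_combination e₃)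
  have f₄ : a * b * i.imK ^ 2 = 0 :=
    mul_left_cancel₀ htwo (by linear_combination f₁ + a * f₂ + b * f₃)
  apply hii
  rw [mul_self_of_re_eq_zero hi, f₁, f₄, sub_zero, zero_smul]

lemma exists_fixed_smul_one (hθ : ∀ (k : K) (x : ℍ[K, a, b]), θ (k • x) = σ k • θ x)
    {x : ℍ[K, a, b]} (hx : x.re = 0) (hθx : θ x = x) (hxx : x * x ≠ 0) :
    ∃ r : fixedSubfield σ, r ≠ 0 ∧ x * x = r • (1 : ℍ[K, a, b]) := by
  have h := mul_self_of_re_eq_zero hx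
  set k := a * x.imI ^ 2 + b * x.imJ ^ 2 - a * b * x.imK ^ 2
  have hk : σ k = k := by
    have e : θ (x * x) = x * x := by rw [map_mul, hθx]
    rw [h, hθ, map_one] at e
    simpa using congrArg QuaternionAlgebra.re e
  refine ⟨⟨k, hk⟩, ?_, h⟩
  rintro h0
  apply hxx
  rw [h, show k = 0 from congrArg Subtype.val h0, zero_smul]

lemma multMap_fixedSubalgebra_bijective (htwo : (2 : K) ≠ 0) (hσ : ∀ x, σ (σ x) = x)
    (hθ : ∀ (k : K) (x : ℍ[K, a, b]), θ (k • x) = σ k • θ x) (hinv : ∀ x, θ (θ x) = x)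
    {d : K} (hd : d ≠ 0) (hσd : σ d = -d) :
    Function.Bijective (multMap σ a b (fixedSubalgebra σ θ hθ)) := by
  have hm : ∀ (k : K) (c : fixedSubalgebra σ θ hθ),
      multMap σ a b (fixedSubalgebra σ θ hθ) (k ⊗ₜ c) = k • (c : ℍ[K, a, b]) := by
    intro k c
    simp [multMap, Algebra.ofId_apply, Algebra.smul_def]
  constructor
  · rw [injective_iff_map_eq_zero]
    intro t ht
    have hform : ∃ c c' : fixedSubalgebra σ θ hθ, t = 1 ⊗ₜ c + d ⊗ₜ c' := by
      clear ht
      induction t using TensorProduct.induction_on with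
      | zero => exact ⟨0, 0, by simp⟩
      | tmul k c =>
        let r : fixedSubfield σ := ⟨2⁻¹ * (k + σ k), by
          change σ (2⁻¹ * (k + σ k)) = 2⁻¹ * (k + σ k)
          rw [map_mul, map_add, hσ, map_inv₀, map_ofNat, add_comm]⟩
        let s : fixedSubfield σ := ⟨(2 * d)⁻¹ * (k - σ k), by
          change σ ((2 * d)⁻¹ * (k - σ k)) = (2 * d)⁻¹ * (k - σ k)
          rw [map_mul, map_sub, hσ, map_inv₀, map_mul, map_ofNat, hσd, mul_neg, inv_neg]
          ring⟩
        refine ⟨r • c, s • c, ?_⟩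
        rw [← TensorProduct.smul_tmul, ← TensorProduct.smul_tmul, ← TensorProduct.add_tmul,
          Subfield.smul_def, Subfield.smul_def]
        congr 1
        simp only [r, s, smul_eq_mul]
        field_simp
        ring
      | add x y hx hy =>
        obtain ⟨c₁, c₁', rfl⟩ := hx
        obtain ⟨c₂, c₂', rfl⟩ := hy
        exact ⟨c₁ + c₂, c₁' + c₂', by rw [TensorProduct.tmul_add, TensorProduct.tmul_add]; abel⟩
    obtain ⟨c, c', rfl⟩ := hform
    rw [map_add, hm, hm, one_smul] at ht
    have hc : θ (c : ℍ[K, a, b]) = c := c.2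
    have hc' : θ (c' : ℍ[K, a, b]) = c' := c'.2
    have ht' := congrArg θ ht
    rw [map_add, hθ, hc, hc', hσd, map_zero, neg_smul] at ht'
    have h₁ : (2 : K) • (c : ℍ[K, a, b]) = 0 := by
      linear_combination (norm := module) ht + ht'
    have h₀ : c = 0 := Subtype.ext (by simpa [htwo] using h₁)
    have h₀' : c' = 0 := Subtype.ext (by simpa [h₀, hd] using ht)
    simp [h₀, h₀']
  · intro x
    obtain ⟨c, -, c', -, hc, hc', rfl⟩ :=
      exists_fixed_add_smul_fixed htwo hθ hinv hd hσd ⊤ (fun _ _ ↦ trivial) (x := x) trivial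
    refine ⟨1 ⊗ₜ ⟨c, hc⟩ + d ⊗ₜ ⟨c', hc'⟩, ?_⟩
    rw [map_add, hm, hm, one_smul]

lemma finrank_eq_four_of_multMap_bijective {S : Subalgebra (fixedSubfield σ) ℍ[K, a, b]}
    (hS : Function.Bijective (multMap σ a b S)) : Module.finrank (fixedSubfield σ) S = 4 := by
  rw [← Module.finrank_baseChange (R := K),
    (AlgEquiv.ofBijective _ hS).toLinearEquiv.finrank_eq, QuaternionAlgebra.finrank_eq_four]

lemma exists_quaternionAlgebra_equiv_fixedSubalgebra (htwo : (2 : K) ≠ 0)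
    (hσ : ∀ x, σ (σ x) = x) (ha : a ≠ 0) (hb : b ≠ 0)
    (hθ : ∀ (k : K) (x : ℍ[K, a, b]), θ (k • x) = σ k • θ x) (hinv : ∀ x, θ (θ x) = x)
    {d : K} (hd : d ≠ 0) (hσd : σ d = -d) :
    ∃ a' b' : fixedSubfield σ, a' ≠ 0 ∧ b' ≠ 0 ∧
      Nonempty (ℍ[fixedSubfield σ, a', b'] ≃ₐ[fixedSubfield σ] fixedSubalgebra σ θ hθ) := by
  have hpure : ∀ x : ℍ[K, a, b], x.re = 0 → (θ x).re = 0 := fun x hx ↦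
    re_map_eq_zero htwo hσ hθ (Function.LeftInverse.injective hinv) hx
  obtain ⟨i, hi, hθi, hii⟩ := exists_fixed_mul_self_ne_zero htwo hθ hinv hd hσd
    (pureSubmodule a b) hpure (x := ⟨0, 1, 0, 0⟩) rfl
    (fun h ↦ ha (by simpa using congrArg QuaternionAlgebra.re h))
  obtain ⟨y, hy, hyy⟩ := exists_anticomm_mul_self_ne_zero htwo ha hb hi hii
  obtain ⟨j, hj, hθj, hjj⟩ := exists_fixed_mul_self_ne_zero htwo hθ hinv hd hσd
    (anticommSubmodule i)
    (fun x hx ↦ mem_anticommSubmodule.2 ⟨hpure x hx.1, by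
      simpa [hθi] using congrArg θ (mem_anticommSubmodule.1 hx).2⟩) hy hyy
  obtain ⟨a', ha', hia⟩ := exists_fixed_smul_one hθ hi hθi hii
  obtain ⟨b', hb', hjb⟩ := exists_fixed_smul_one hθ hj.1 hθj hjj
  have hij : j * i = -(i * j) := (neg_eq_of_add_eq_zero_right (mem_anticommSubmodule.1 hj).2).symm
  let B : QuaternionAlgebra.Basis (fixedSubalgebra σ θ hθ) a' 0 b' :=
    { i := ⟨i, hθi⟩
      j := ⟨j, hθj⟩
      k := ⟨i, hθi⟩ * ⟨j, hθj⟩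
      i_mul_i := Subtype.ext (by simpa using hia)
      j_mul_j := Subtype.ext (by simpa using hjb)
      i_mul_j := rfl
      j_mul_i := Subtype.ext (by simpa using hij) }
  have hinjB : Function.Injective B.liftHom :=
    liftHom_injective (fun h ↦ htwo (congrArg Subtype.val h)) ha' hb' B
  have h4 : Module.finrank (fixedSubfield σ) (fixedSubalgebra σ θ hθ) = 4 :=
    finrank_eq_four_of_multMap_bijective
      (multMap_fixedSubalgebra_bijective htwo hσ hθ hinv hd hσd)
  have : Module.Finite (fixedSubfield σ) (fixedSubalgebra σ θ hθ) :=
    Module.finite_of_finrank_pos (by omega)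
  have hsurjB : Function.Surjective B.liftHom :=
    (LinearMap.injective_iff_surjective_of_finrank_eq_finrank (f := B.liftHom.toLinearMap)
      (by rw [h4, QuaternionAlgebra.finrank_eq_four])).1 hinjB
  exact ⟨a', b', ha', hb', ⟨AlgEquiv.ofBijective B.liftHom ⟨hinjB, hsurjB⟩⟩⟩

end Semilinear

/-- Paper's first Lemma of §6: let `K` be a field of characteristic `≠ 2`, `σ` a nontrivial
involutive automorphism of `K` with fixed field `F = K^σ`, `L = ℍ[K, a, b]` (`a, b ≠ 0`) a
quaternion algebra over `K` with main involution `star`, and `τ` an involution of the second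
kind on `L`.  Put `C = {l ∈ L : τ(star l) = l}`.  Then `C` is an `F`-subalgebra of `L`,
stable under the main involution, on which `τ` coincides with `star`; the multiplication map
`K ⊗_F C → L`, `k ⊗ c ↦ k • c`, is an isomorphism of `K`-algebras; in particular `C` is a
`4`-dimensional central simple `F`-algebra, indeed a quaternion algebra `ℍ[F, a', b']` over
`F`; and under the isomorphism `L ≅ C ⊗_F K` the involution `τ` corresponds to
`c ⊗ k ↦ star c ⊗ σ(k)`. -/
theorem exists_descended_quaternion_algebra
    (htwo : (2 : K) ≠ 0)
    (σ : K ≃+* K) (hσinvol : ∀ x, σ (σ x) = x) (hσne : σ ≠ RingEquiv.refl K)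
    (a b : K) (ha : a ≠ 0) (hb : b ≠ 0)
    (τ : ℍ[K, a, b] → ℍ[K, a, b])
    (hτbij : Function.Bijective τ)
    (hτadd : ∀ x y, τ (x + y) = τ x + τ y)
    (hτmul : ∀ x y, τ (x * y) = τ y * τ x)
    (hτinvol : ∀ x, τ (τ x) = x)
    (hτsmul : ∀ (k : K) (x : ℍ[K, a, b]), τ (k • x) = σ k • τ x) :
    ∃ S : Subalgebra (fixedSubfield σ) ℍ[K, a, b],
      -- (1) `C = {l : τ (star l) = l}` is an `F`-subalgebra of `L`
      (S : Set ℍ[K, a, b]) = {l | τ (star l) = l} ∧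
      -- (2) `C` is stable under the main involution, and `τ = star` on `C`
      (∀ l : ℍ[K, a, b], l ∈ S → star l ∈ S) ∧
      (∀ l ∈ S, τ l = star l) ∧
      -- (3) the multiplication map `K ⊗_F C → L` is an isomorphism of `K`-algebras
      Function.Bijective (multMap σ a b S) ∧
      -- in particular `C` is a `4`-dimensional central simple `F`-algebra:
      -- a quaternion algebra over `F`
      Module.finrank (fixedSubfield σ) S = 4 ∧
      (∃ a' b' : fixedSubfield σ, a' ≠ 0 ∧ b' ≠ 0 ∧
        Nonempty (ℍ[fixedSubfield σ, a', b'] ≃ₐ[fixedSubfield σ] S)) ∧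
      -- under the isomorphism `L ≅ C ⊗_F K`, `τ` corresponds to `c ⊗ k ↦ star c ⊗ σ(k)`
      (∀ (k : K), ∀ c ∈ S, τ (k • c) = σ k • star c) := by
  have hτone : τ 1 = 1 := by
    simpa [hτinvol] using (hτmul (τ 1) 1).symm
  have hτzero : τ 0 = 0 := by simpa using hτadd 0 0
  let θ : ℍ[K, a, b] →+* ℍ[K, a, b] :=
    { toFun x := τ (star x)
      map_one' := by rw [star_one, hτone]
      map_mul' x y := by rw [star_mul, hτmul]
      map_zero' := by rw [star_zero, hτzero]
      map_add' x y := by rw [star_add, hτadd] }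
  have hθ : ∀ (k : K) (x : ℍ[K, a, b]), θ (k • x) = σ k • θ x := fun k x ↦ by
    change τ (star (k • x)) = σ k • τ (star x)
    rw [QuaternionAlgebra.star_smul', hτsmul]
  have hinj : Function.Injective θ := hτbij.injective.comp star_injective
  have hstar : ∀ x, θ (star x) = star (θ x) := map_star_of_semilinear htwo hσinvol hθ hinj
  have hinv : ∀ x, θ (θ x) = x := fun x ↦ by
    change τ (star (θ x)) = x
    rw [← hstar]
    change τ (τ (star (star x))) = x
    rw [hτinvol, star_star]
  obtain ⟨d, hd, hσd⟩ := exists_ne_zero_map_eq_neg hσinvol hσne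
  have hbij := multMap_fixedSubalgebra_bijective htwo hσinvol hθ hinv hd hσd
  have hmem : ∀ l ∈ fixedSubalgebra σ θ hθ, star l ∈ fixedSubalgebra σ θ hθ := fun l hl ↦ by
    change θ (star l) = star l
    rw [hstar, show θ l = l from hl]
  have hτstar : ∀ l ∈ fixedSubalgebra σ θ hθ, τ l = star l := fun l hl ↦ by
    simpa [θ] using show θ (star l) = star l from hmem l hl
  refine ⟨fixedSubalgebra σ θ hθ, rfl, hmem, hτstar, hbij,
    finrank_eq_four_of_multMap_bijective hbij,
    exists_quaternionAlgebra_equiv_fixedSubalgebra htwo hσinvol ha hb hθ hinv hd hσd, ?_⟩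
  intro k c hc
  rw [hτsmul, hτstar c hc]

end CherednikDescent

end
end

section
/- Let K be a field, σ a ring automorphism of K, a, b ∈ K, and τ a σ-semilinear anti-automorphism of the quaternion algebra ℍ[K, a, b]. Then τ commutes with the main involution: τ(star x) = star(τ(x)) for all x ∈ ℍ[K, a, b]. (This is the identity (l′)^ι = (l^ι)′ between an involution of the second kind and the main involution, proved in the paper via the invariance of the reduced trace.) -/
open scoped Quaternion

/-- Every quaternion satisfies its reduced characteristic polynomial. -/
theorem QuaternionAlgebra.mul_self_eq_two_re_smul_sub {K : Type*} [CommRing K] {a b : K}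
    (x : ℍ[K, a, b]) :
    x * x = (2 * x.re) • x +
      (-(x.re ^ 2 - a * x.imI ^ 2 - b * x.imJ ^ 2 + a * b * x.imK ^ 2)) • (1 : ℍ[K, a, b]) := by
  ext <;> simp <;> ring

/-- A quaternion plus its conjugate is its reduced trace. -/
theorem QuaternionAlgebra.add_star_eq_two_re_smul_one {K : Type*} [CommRing K] {a b : K}
    (x : ℍ[K, a, b]) : x + star x = (2 * x.re) • (1 : ℍ[K, a, b]) := by
  ext <;> simp
  ring

/-- If `y * y = t • y + n • 1` and `y` is not a scalar, then `t` is the reduced trace of `y`. -/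
theorem QuaternionAlgebra.eq_two_re_of_mul_self_eq {K : Type*} [Field K] {a b : K}
    {y : ℍ[K, a, b]} {t n : K} (h : y * y = t • y + n • (1 : ℍ[K, a, b]))
    (hy : y ≠ y.re • (1 : ℍ[K, a, b])) : t = 2 * y.re := by
  rw [mul_self_eq_two_re_smul_sub] at h
  have hI : 2 * y.re * y.imI = t * y.imI := by simpa using congrArg imI h
  have hJ : 2 * y.re * y.imJ = t * y.imJ := by simpa using congrArg imJ h
  have hK : 2 * y.re * y.imK = t * y.imK := by simpa using congrArg imK h
  by_contra ht
  have ht' : 2 * y.re ≠ t := Ne.symm ht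
  refine hy (QuaternionAlgebra.ext (by simp) ?_ ?_ ?_)
  · simpa using (mul_eq_mul_right_iff.mp hI).resolve_left ht'
  · simpa using (mul_eq_mul_right_iff.mp hJ).resolve_left ht'
  · simpa using (mul_eq_mul_right_iff.mp hK).resolve_left ht'

/-- A `σ`-semilinear anti-automorphism `τ` of a quaternion algebra `ℍ[K, a, b]` over a field `K`
commutes with the main (standard) involution: `τ (star x) = star (τ x)` for all `x`.
This is the identity `(l′)^ι = (l^ι)′` of the paper, proved there via the invariance of the
reduced trace. -/
theorem semilinear_antiautomorphism_commutes_with_star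
    {K : Type*} [Field K] (σ : K ≃+* K) (a b : K)
    (τ : ℍ[K, a, b] → ℍ[K, a, b])
    (hbij : Function.Bijective τ)
    (hadd : ∀ x y, τ (x + y) = τ x + τ y)
    (hmul : ∀ x y, τ (x * y) = τ y * τ x)
    (hone : τ 1 = 1)
    (hsmul : ∀ (k : K) (x : ℍ[K, a, b]), τ (k • x) = σ k • τ x) :
    ∀ x : ℍ[K, a, b], τ (star x) = star (τ x) := by
  intro x
  have htr : σ (2 * x.re) = 2 * (τ x).re := by
    by_cases hy : τ x = (τ x).re • (1 : ℍ[K, a, b])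
    · have hx : x = σ.symm (τ x).re • (1 : ℍ[K, a, b]) := by
        apply hbij.injective
        rw [hsmul, hone, σ.apply_symm_apply]
        exact hy
      have hre : x.re = σ.symm (τ x).re := by
        simpa using congrArg QuaternionAlgebra.re hx
      rw [hre, map_mul, map_ofNat, σ.apply_symm_apply]
    · have h := congrArg τ (QuaternionAlgebra.mul_self_eq_two_re_smul_sub x)
      rw [hmul, hadd, hsmul, hsmul, hone] at h
      exact QuaternionAlgebra.eq_two_re_of_mul_self_eq h hy
  have h := congrArg τ (QuaternionAlgebra.add_star_eq_two_re_smul_one x)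
  rw [hadd, hsmul, hone, htr, ← QuaternionAlgebra.add_star_eq_two_re_smul_one] at h
  exact add_left_cancel h
end
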